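/- Suppose x₀ = y₀ and that both eigenvalues λ₁, λ₂ of D²u₀(x₀) are negative, and set λ = max{λ₁, λ₂}. Then any choice of maximum points x_ε of u_ε satisfies: (i) |log ε|·|x_ε − x₀|² → −u₀(x₀)/λ as ε → 0⁺, and (ii) the unit vectors (x_ε − x₀)/|x_ε − x₀| are asymptotically eigenvectors of D²u₀(x₀) for the eigenvalue λ, i.e. |D²u₀(x₀)·(x_ε − x₀) − λ·(x_ε − x₀)|/|x_ε − x₀| → 0 as ε → 0⁺. -/

import Mathlib

open Real Set Metric Filter Topology

noncomputable section

abbrev E2 := EuclideanSpace ℝ (Fin 2)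

/-- Second partial derivative `∂²u/∂xᵢ∂xⱼ` at `x`. -/
noncomputable def pd2 (u : E2 → ℝ) (x : E2) (i j : Fin 2) : ℝ :=
  fderiv ℝ (fun y => fderiv ℝ u y (EuclideanSpace.single j 1)) x (EuclideanSpace.single i 1)

/-- The Hessian matrix `D²u(x)`. -/
noncomputable def Hess (u : E2 → ℝ) (x : E2) : Matrix (Fin 2) (Fin 2) ℝ :=
  Matrix.of fun i j => pd2 u x i j

/-- The Laplacian `Δu(x)`. -/
noncomputable def lap (u : E2 → ℝ) (x : E2) : ℝ := pd2 u x 0 0 + pd2 u x 1 1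

/-- The largest eigenvalue of a symmetric 2×2 real matrix. -/
noncomputable def lambdaMax (M : Matrix (Fin 2) (Fin 2) ℝ) : ℝ :=
  ((M 0 0 + M 1 1) + Real.sqrt ((M 0 0 - M 1 1) ^ 2 + (M 0 1 + M 1 0) ^ 2)) / 2

/-- `u` is the torsion function of `U`: continuous up to the boundary, `C²` inside,
`Δu = -1` in `U` and `u = 0` on `∂U`. -/
def IsTorsion (U : Set E2) (u : E2 → ℝ) : Prop :=
  ContinuousOn u (closure U) ∧ (∀ x ∈ U, ContDiffAt ℝ 2 u x) ∧
    (∀ x ∈ U, lap u x = -1) ∧ (∀ x ∈ frontier U, u x = 0)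


/-- Euclidean norm of a plane vector given by coordinates. -/
noncomputable def vnorm (v : Fin 2 → ℝ) : ℝ := Real.sqrt (v 0 ^ 2 + v 1 ^ 2)

section Harmonic

open InnerProductSpace Laplacian

variable {E F : Type*} [NormedAddCommGroup E] [InnerProductSpace ℝ E]
  [NormedAddCommGroup F] [InnerProductSpace ℝ F]

/-- Second derivative of a quadratic form given by a bilinear map. -/
lemma fderiv_fderiv_bilin (B : E →L[ℝ] E →L[ℝ] ℝ) (x v w : E) :
    fderiv ℝ (fderiv ℝ (fun y => B y y)) x v w = B v w + B w v := by
  have h1 : fderiv ℝ (fun y => B y y) = fun y => (B + B.flip) y := by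
    ext y z
    have := (B.hasFDerivAt (x := y)).clm_apply (hasFDerivAt_id (𝕜 := ℝ) y)
    simp only [id] at this
    rw [this.fderiv]
    simp
  rw [h1]
  rw [ContinuousLinearMap.fderiv]
  simp

lemma contDiff_bilin (B : E →L[ℝ] E →L[ℝ] ℝ) : ContDiff ℝ 2 (fun y => B y y) :=
  B.contDiff.clm_apply contDiff_id

/-- At a local maximum, second directional derivatives are nonpositive. -/
lemma fderiv_fderiv_nonpos_of_isLocalMax {f : E → ℝ} {x : E} (hf : ContDiffAt ℝ 2 f x)
    (hx : IsLocalMax f x) (v : E) : fderiv ℝ (fderiv ℝ f) x v v ≤ 0 := by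
  by_contra! hpos
  set l : ℝ → E := fun t => x + t • v with hl
  have hl0 : l 0 = x := by simp [hl]
  have hld : ∀ t, HasDerivAt l v t := fun t => by
    simpa [hl] using ((hasDerivAt_id t).smul_const v).const_add x
  have hlc : ContinuousAt l 0 := (hld 0).continuousAt
  have hlt : Tendsto l (𝓝 0) (𝓝 x) := by simpa [hl0] using hlc.tendsto
  have hev : ∀ᶠ y in 𝓝 x, ContDiffAt ℝ 2 f y := hf.eventually (by simp)
  have hd : deriv (f ∘ l) =ᶠ[𝓝 0] fun t => fderiv ℝ f (l t) v := by
    filter_upwards [hlt.eventually hev] with t ht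
    exact ((ht.differentiableAt (by simp)).hasFDerivAt.comp_hasDerivAt t (hld t)).deriv
  have hd2 : deriv (deriv (f ∘ l)) 0 = fderiv ℝ (fderiv ℝ f) x v v := by
    rw [hd.deriv_eq]
    have h1 : DifferentiableAt ℝ (fderiv ℝ f) (l 0) := by
      rw [hl0]
      exact (hf.fderiv_right (m := 1) (by norm_num)).differentiableAt (by simp)
    have h2 := (h1.hasFDerivAt.comp_hasDerivAt 0 (hld 0)).clm_apply (hasDerivAt_const 0 v)
    simpa [hl0] using h2.deriv
  have hmax : IsLocalMax (f ∘ l) 0 := by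
    have : ∀ᶠ t in 𝓝 (0 : ℝ), f (l t) ≤ f x := hlt.eventually hx
    filter_upwards [this] with t ht
    simpa [hl0] using ht
  have hmin : IsLocalMin (f ∘ l) 0 := by
    refine isLocalMin_of_deriv_deriv_pos (by rw [hd2]; exact hpos) hmax.deriv_eq_zero ?_
    refine ContinuousAt.comp ?_ hlc
    rw [hl0]; exact hf.continuousAt
  have hc : f ∘ l =ᶠ[𝓝 0] fun _ => f x := by
    filter_upwards [hmax, hmin] with t h1 h2
    have := le_antisymm h1 h2
    simpa [hl0] using this
  have : deriv (deriv (f ∘ l)) 0 = 0 := by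
    rw [hc.deriv.deriv_eq]; simp
  rw [hd2] at this
  exact hpos.ne' this

variable [FiniteDimensional ℝ E] [FiniteDimensional ℝ F]

/-- The Laplacian as a trace of the second Fréchet derivative. -/
lemma laplacian_eq_sum_fderiv_fderiv {ι : Type*} [Fintype ι] (f : E → ℝ)
    (v : OrthonormalBasis ι ℝ E) (x : E) :
    Δ f x = ∑ i, fderiv ℝ (fderiv ℝ f) x (v i) (v i) := by
  rw [laplacian_eq_iteratedFDeriv_orthonormalBasis f v]
  simp [iteratedFDeriv_two_apply]

lemma laplacian_comp_isometry_add (f : F → ℝ) (T : E ≃ₗᵢ[ℝ] F) (c : F) (x : E) :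
    Δ (fun y => f (T y + c)) x = Δ f (T x + c) := by
  have h1 : (fun y => f (T y + c)) =
      (fun z => f (z + c)) ∘ (T.toContinuousLinearEquiv : E ≃L[ℝ] F) := rfl
  rw [laplacian_eq_iteratedFDeriv_orthonormalBasis _ (stdOrthonormalBasis ℝ E),
    laplacian_eq_iteratedFDeriv_orthonormalBasis f ((stdOrthonormalBasis ℝ E).map T)]
  refine Finset.sum_congr rfl fun i _ => ?_
  rw [h1, ← iteratedFDerivWithin_univ,
    ← preimage_univ (f := (T.toContinuousLinearEquiv : E ≃L[ℝ] F)),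
    ContinuousLinearEquiv.iteratedFDerivWithin_comp_right _ _ uniqueDiffOn_univ (mem_univ _)]
  rw [iteratedFDerivWithin_univ, iteratedFDeriv_comp_add_right]
  simp only [ContinuousMultilinearMap.compContinuousLinearMap_apply]
  congr 1
  ext j
  fin_cases j <;> rfl

lemma harmonicAt_comp_isometry_add {f : F → ℝ} (T : E ≃ₗᵢ[ℝ] F) (c : F) {x : E}
    (h : HarmonicAt f (T x + c)) : HarmonicAt (fun y => f (T y + c)) x := by
  have hT : ContDiff ℝ 2 (fun y => T y + c) := T.contDiff.add contDiff_const
  refine ⟨h.1.comp x hT.contDiffAt, ?_⟩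
  have := (hT.continuous.tendsto x).eventually h.2
  filter_upwards [this] with y hy
  rw [laplacian_comp_isometry_add, hy]
  rfl

lemma harmonicContOnCl_comp_isometry_add {f : F → ℝ} (T : E ≃ₗᵢ[ℝ] F) (c : F) {U : Set E}
    {V : Set F} (h : HarmonicContOnCl f V) (hm : MapsTo (fun y => T y + c) U V) :
    HarmonicContOnCl (fun y => f (T y + c)) U := by
  refine ⟨fun x hx => harmonicAt_comp_isometry_add T c (h.1 _ (hm hx)), ?_⟩
  have hT : Continuous (fun y => T y + c) := T.continuous.add continuous_const
  exact h.2.comp hT.continuousOn (hm.closure hT)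

lemma laplacian_bilin {ι : Type*} [Fintype ι] (v : OrthonormalBasis ι ℝ E)
    (B : E →L[ℝ] E →L[ℝ] ℝ) (x : E) :
    Δ (fun y => B y y) x = 2 * ∑ i, B (v i) (v i) := by
  simp only [laplacian_eq_sum_fderiv_fderiv _ v, fderiv_fderiv_bilin, ← two_mul, Finset.mul_sum]

lemma harmonicAt_clm (l : E →L[ℝ] ℝ) (x : E) : HarmonicAt l x := by
  refine ⟨l.contDiff.contDiffAt, Eventually.of_forall fun y => ?_⟩
  have h : fderiv ℝ (l : E → ℝ) = fun _ => l := by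
    ext1 z; exact l.fderiv
  rw [laplacian_eq_sum_fderiv_fderiv _ (stdOrthonormalBasis ℝ E), h]
  simp

end Harmonic

section MaximumPrinciple

open InnerProductSpace Laplacian

variable {E : Type*} [NormedAddCommGroup E] [InnerProductSpace ℝ E] [FiniteDimensional ℝ E]

/-- Weak maximum principle for harmonic functions on a bounded open set. -/
lemma le_of_le_on_frontier [Nontrivial E] {U : Set E} (hU : IsOpen U)
    (hb : Bornology.IsBounded U) {v : E → ℝ} (hv : HarmonicContOnCl v U) {M : ℝ}
    (hM : ∀ x ∈ frontier U, v x ≤ M) {p : E} (hp : p ∈ U) : v p ≤ M := by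
  by_contra! hlt
  obtain ⟨D, hD0, hD⟩ := hb.closure.exists_pos_norm_le
  set η : ℝ := (v p - M) / (2 * D ^ 2) with hη
  have hη0 : 0 < η := by have := sub_pos.2 hlt; positivity
  have hηD : η * D ^ 2 < v p - M := by
    rw [hη]; field_simp; linarith
  set B : E →L[ℝ] E →L[ℝ] ℝ := η • innerSL ℝ with hB
  have hBy : ∀ y, B y y = η * ‖y‖ ^ 2 := fun y => by
    change η * inner ℝ y y = _
    rw [real_inner_self_eq_norm_sq]
  set W : E → ℝ := v + fun y => B y y with hW
  have hWy : ∀ y, W y = v y + η * ‖y‖ ^ 2 := fun y => by simp [hW, hBy]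
  have hWc : ContinuousOn W (closure U) :=
    hv.2.add (contDiff_bilin B).continuous.continuousOn
  have hcpt : IsCompact (closure U) := Metric.isCompact_of_isClosed_isBounded isClosed_closure
    hb.closure
  obtain ⟨q, hq, hqmax⟩ := hcpt.exists_isMaxOn ⟨p, subset_closure hp⟩ hWc
  have hpq : W p ≤ W q := hqmax (subset_closure hp)
  by_cases hqU : q ∈ U
  · have hloc : IsLocalMax W q :=
      (hqmax.on_subset subset_closure).isLocalMax (hU.mem_nhds hqU)
    have hvq := (hv.1 q hqU).1
    have hBq := (contDiff_bilin B).contDiffAt (x := q)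
    have hle : Δ W q ≤ 0 := by
      rw [laplacian_eq_sum_fderiv_fderiv _ (stdOrthonormalBasis ℝ E)]
      exact Finset.sum_nonpos fun i _ =>
        fderiv_fderiv_nonpos_of_isLocalMax (hvq.add hBq) hloc _
    rw [hW, hvq.laplacian_add hBq, (hv.1 q hqU).2.self_of_nhds,
      laplacian_bilin (stdOrthonormalBasis ℝ E)] at hle
    simp only [hBy, OrthonormalBasis.norm_eq_one, Finset.sum_const, Finset.card_univ,
      Fintype.card_fin, Pi.zero_apply] at hle
    have : 0 < Module.finrank ℝ E := Module.finrank_pos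
    have : 0 < 2 * Module.finrank ℝ E • (η * 1 ^ 2) := by positivity
    linarith
  · have hqf : q ∈ frontier U := by
      rw [hU.frontier_eq]; exact ⟨hq, hqU⟩
    have h1 := hM q hqf
    have h2 : ‖q‖ ^ 2 ≤ D ^ 2 := pow_le_pow_left₀ (norm_nonneg _) (hD q hq) 2
    have h3 := mul_le_mul_of_nonneg_left h2 hη0.le
    have h4 : 0 ≤ η * ‖p‖ ^ 2 := by positivity
    rw [hWy, hWy] at hpq
    linarith

/-- Comparison of two harmonic functions on a bounded open set. -/
lemma le_of_le_on_frontier₂ [Nontrivial E] {U : Set E} (hU : IsOpen U)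
    (hb : Bornology.IsBounded U) {v g : E → ℝ} (hv : HarmonicContOnCl v U)
    (hg : HarmonicContOnCl g U) (hM : ∀ x ∈ frontier U, v x ≤ g x) {p : E} (hp : p ∈ U) :
    v p ≤ g p := by
  have := le_of_le_on_frontier hU hb (hv.sub hg) (M := 0)
    (fun x hx => by simpa using hM x hx) hp
  simpa using this

end MaximumPrinciple

section Plane

open InnerProductSpace Laplacian

lemma harmonicAt_log_norm {x : E2} (hx : x ≠ 0) : HarmonicAt (fun y : E2 => Real.log ‖y‖) x := by
  have T : E2 ≃ₗᵢ[ℝ] ℂ := Complex.orthonormalBasisOneI.repr.symm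
  have h : HarmonicAt (fun z : ℂ => Real.log ‖z‖) (T x + 0) :=
    AnalyticAt.harmonicAt_log_norm analyticAt_id (by simpa using hx)
  simpa using harmonicAt_comp_isometry_add T 0 h

/-- A harmonic barrier on a half disc. -/
lemma harmonicAt_halfDisc_barrier {n : E2} (hn : ‖n‖ = 1) (R : ℝ) (x : E2) :
    HarmonicAt (fun y : E2 => 2 * inner ℝ n y / R + (‖y‖ ^ 2 - 2 * inner ℝ n y ^ 2) / R ^ 2) x := by
  let S : E2 →L[ℝ] E2 →L[ℝ] ℝ := innerSL ℝ
  set B : E2 →L[ℝ] E2 →L[ℝ] ℝ := (1 / R ^ 2) • (S -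
      (2 : ℝ) • (innerSL ℝ n).smulRight (innerSL ℝ n)) with hB
  have hBy : ∀ y, B y y = 1 / R ^ 2 * (‖y‖ ^ 2 - 2 * inner ℝ n y ^ 2) := fun y => by
    change 1 / R ^ 2 * (inner ℝ y y - 2 * (inner ℝ n y * inner ℝ n y)) = _
    rw [real_inner_self_eq_norm_sq, sq (inner ℝ n y)]
  have h1 : HarmonicAt (fun y : E2 => B y y) x := by
    refine ⟨(contDiff_bilin B).contDiffAt, Eventually.of_forall fun y => ?_⟩
    rw [laplacian_bilin (EuclideanSpace.basisFun (Fin 2) ℝ)]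
    have : n 0 ^ 2 + n 1 ^ 2 = 1 := by
      have := EuclideanSpace.norm_sq_eq n
      rw [hn] at this
      simpa [Fin.sum_univ_two] using this.symm
    simp only [hBy, OrthonormalBasis.norm_eq_one, Fin.sum_univ_two,
      EuclideanSpace.inner_basisFun_real, Pi.zero_apply]
    rw [← mul_add]
    have : (1 ^ 2 - 2 * n 0 ^ 2 + (1 ^ 2 - 2 * n 1 ^ 2) : ℝ) = 0 := by linarith
    rw [this]
    simp
  have h2 := harmonicAt_clm ((2 / R) • innerSL ℝ n) x
  convert h2.add h1 using 1
  ext y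
  simp only [Pi.add_apply, hBy]
  change _ = 2 / R * inner ℝ n y + _
  ring

end Plane

section Annulus

open InnerProductSpace Laplacian

lemma harmonicContOnCl_log_norm {U : Set E2} (hU : ∀ y ∈ closure U, y ≠ 0) (c β : ℝ) :
    HarmonicContOnCl (fun y : E2 => c + β * Real.log ‖y‖) U := by
  refine (HarmonicContOnCl.const_smul (c := β) (f := fun y : E2 => Real.log ‖y‖)
    ⟨fun x hx => harmonicAt_log_norm (hU x (subset_closure hx)), ?_⟩).const_add c
  exact continuousOn_id.norm.log fun y hy => norm_ne_zero_iff.2 (hU y hy)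

/-- The open annulus `ε < ‖y‖ < R` centred at the origin. -/
def annulus (ε R : ℝ) : Set E2 := {y | ε < ‖y‖ ∧ ‖y‖ < R}

lemma isOpen_annulus (ε R : ℝ) : IsOpen (annulus ε R) :=
  (isOpen_lt continuous_const continuous_norm).inter (isOpen_lt continuous_norm continuous_const)

lemma isBounded_annulus (ε R : ℝ) : Bornology.IsBounded (annulus ε R) :=
  (isBounded_ball (x := (0 : E2)) (r := R)).subset fun y hy => by simpa using hy.2

lemma norm_mem_of_mem_closure_annulus {ε R : ℝ} {y : E2} (hy : y ∈ closure (annulus ε R)) :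
    ε ≤ ‖y‖ ∧ ‖y‖ ≤ R := by
  have hc : IsClosed {y : E2 | ε ≤ ‖y‖ ∧ ‖y‖ ≤ R} :=
    (isClosed_le continuous_const continuous_norm).inter
      (isClosed_le continuous_norm continuous_const)
  exact closure_minimal
    (fun y (hy : ε < ‖y‖ ∧ ‖y‖ < R) => (⟨hy.1.le, hy.2.le⟩ : ε ≤ ‖y‖ ∧ ‖y‖ ≤ R)) hc hy

lemma norm_eq_of_mem_frontier_annulus {ε R : ℝ} {y : E2} (hy : y ∈ frontier (annulus ε R)) :
    ‖y‖ = ε ∨ ‖y‖ = R := by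
  rw [(isOpen_annulus ε R).frontier_eq] at hy
  obtain ⟨h1, h2⟩ := norm_mem_of_mem_closure_annulus hy.1
  by_contra! h
  exact hy.2 ⟨lt_of_le_of_ne h1 h.1.symm, lt_of_le_of_ne h2 h.2⟩

lemma annulus_subset_annulus {ε ρ R : ℝ} (h : ρ ≤ R) : annulus ε ρ ⊆ annulus ε R :=
  fun _ hy => ⟨hy.1, hy.2.trans_le h⟩

/-- A harmonic function in an annulus which is nearly constant on the inner circle has small
oscillation on circles of small radius: compare it with its reflection. -/
lemma sub_le_of_harmonic_annulus {ε R a κ m : ℝ} (hε : 0 < ε) {w : E2 → ℝ}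
    (hw : HarmonicContOnCl w (annulus ε R)) (hin : ∀ y, ‖y‖ = ε → |w y - a| ≤ κ)
    (hout : ∀ y, ‖y‖ = R → 0 ≤ w y ∧ w y ≤ m) {x x' : E2} (hx : x ∈ annulus ε R)
    (hxx' : ‖x‖ = ‖x'‖) : w x - w x' ≤ 2 * κ + 3 * m * (‖x‖ / R) := by
  have hR : 0 < R := (hε.trans hx.1).trans hx.2
  obtain ⟨p, hp⟩ := exists_norm_eq E2 hR.le
  obtain ⟨p', hp'⟩ := exists_norm_eq E2 hε.le
  have hm : 0 ≤ m := (hout p hp).1.trans (hout p hp).2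
  have hκ : 0 ≤ κ := (abs_nonneg _).trans (hin p' hp')
  rcases eq_or_ne x x' with rfl | hne
  · rw [sub_self]; positivity
  set d := x - x' with hd
  have hd0 : d ≠ 0 := sub_ne_zero.2 hne
  have hdn : 0 < ‖d‖ := norm_pos_iff.2 hd0
  set n : E2 := ‖d‖⁻¹ • d with hn
  have hn1 : ‖n‖ = 1 := by rw [hn, norm_smul, norm_inv, norm_norm, inv_mul_cancel₀ hdn.ne']
  set Q : E2 ≃ₗᵢ[ℝ] E2 := (ℝ ∙ d)ᗮ.reflection with hQ
  have hQx : Q x = x' := Submodule.reflection_sub hxx'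
  set U : Set E2 := annulus ε R ∩ {y | 0 < inner ℝ n y} with hUdef
  have hUo : IsOpen U :=
    (isOpen_annulus ε R).inter (isOpen_lt continuous_const (by fun_prop))
  have hUb : Bornology.IsBounded U := (isBounded_annulus ε R).subset inter_subset_left
  have hxU : x ∈ U := by
    refine ⟨hx, ?_⟩
    have h1 : inner ℝ d x = ‖d‖ ^ 2 / 2 := by
      have h2 := norm_sub_sq_real x x'
      rw [← hxx', ← hd] at h2
      have h3 : inner ℝ d x = ‖x‖ ^ 2 - inner ℝ x x' := by
        rw [hd, inner_sub_left, real_inner_self_eq_norm_sq, real_inner_comm]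
      linarith
    change 0 < inner ℝ n x
    rw [hn, real_inner_smul_left, h1]
    positivity
  have hwQ : HarmonicContOnCl (fun y => w (Q y + 0)) U :=
    harmonicContOnCl_comp_isometry_add Q 0 hw fun y hy => by
      simpa [annulus, LinearIsometryEquiv.norm_map] using hy.1
  simp only [add_zero] at hwQ
  have hv := (hw.mono (inter_subset_left : U ⊆ annulus ε R)).sub hwQ
  have hB0 : HarmonicContOnCl
      (fun y : E2 => 2 * inner ℝ n y / R + (‖y‖ ^ 2 - 2 * inner ℝ n y ^ 2) / R ^ 2) U :=
    ⟨fun x _ => harmonicAt_halfDisc_barrier hn1 R x, by fun_prop⟩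
  have hB := (hB0.const_smul m).const_add (2 * κ)
  have hcmp := le_of_le_on_frontier₂ hUo hUb hv hB ?_ hxU
  · simp only [Pi.sub_apply, hQx, smul_eq_mul, Pi.smul_apply, Pi.add_apply] at hcmp
    refine hcmp.trans ?_
    have hin1 : inner ℝ n x ≤ ‖x‖ := by
      simpa [hn1] using real_inner_le_norm n x
    have hxR : ‖x‖ / R ≤ 1 := (div_le_one hR).2 hx.2.le
    have h0 : 0 ≤ ‖x‖ / R := by positivity
    have h1 : 2 * inner ℝ n x / R ≤ 2 * (‖x‖ / R) := by
      rw [mul_div_assoc]; gcongr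
    have h2 : (‖x‖ ^ 2 - 2 * inner ℝ n x ^ 2) / R ^ 2 ≤ ‖x‖ / R := by
      calc (‖x‖ ^ 2 - 2 * inner ℝ n x ^ 2) / R ^ 2 ≤ ‖x‖ ^ 2 / R ^ 2 := by
            gcongr; nlinarith [sq_nonneg (inner ℝ n x)]
        _ = (‖x‖ / R) * (‖x‖ / R) := by ring
        _ ≤ (‖x‖ / R) * 1 := by gcongr
        _ = _ := mul_one _
    have h3 := mul_le_mul_of_nonneg_left (add_le_add h1 h2) hm
    linarith
  · intro y hy
    have hcl : y ∈ closure (annulus ε R) :=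
      closure_mono inter_subset_left (frontier_subset_closure hy)
    obtain ⟨hy1, hy2⟩ := norm_mem_of_mem_closure_annulus hcl
    have hyn : 0 ≤ inner ℝ n y := by
      have hc : IsClosed {y : E2 | 0 ≤ inner ℝ n y} :=
        isClosed_le continuous_const (by fun_prop)
      exact closure_minimal (fun y (hy : _ ∧ 0 < inner ℝ n y) => hy.2.le) hc
        (frontier_subset_closure hy)
    have hyn1 : inner ℝ n y ≤ ‖y‖ := by simpa [hn1] using real_inner_le_norm n y
    simp only [Pi.sub_apply, smul_eq_mul, Pi.smul_apply, Pi.add_apply]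
    set s := inner ℝ n y with hs
    have hsR : s / R ≤ 1 := (div_le_one hR).2 (hyn1.trans hy2)
    have hs0 : 0 ≤ s / R := by positivity
    have hBexp : 2 * s / R + (‖y‖ ^ 2 - 2 * s ^ 2) / R ^ 2
        = 2 * (s / R) + (‖y‖ / R) ^ 2 - 2 * (s / R) ^ 2 := by ring
    rw [hBexp]
    have hBnn : 0 ≤ 2 * (s / R) + (‖y‖ / R) ^ 2 - 2 * (s / R) ^ 2 := by
      nlinarith [sq_nonneg (‖y‖ / R), mul_le_mul_of_nonneg_left hsR hs0]
    have hQn : ‖Q y‖ = ‖y‖ := Q.norm_map y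
    by_cases he : ‖y‖ = ε
    · have h1 := abs_le.1 (hin y he)
      have h2 := abs_le.1 (hin (Q y) (hQn.trans he))
      have h3 := mul_nonneg hm hBnn
      linarith [h1.2, h2.1]
    by_cases he' : ‖y‖ = R
    · have h1 := (hout y he').2
      have h2 := (hout (Q y) (hQn.trans he')).1
      have h3 : 1 ≤ 2 * (s / R) + (‖y‖ / R) ^ 2 - 2 * (s / R) ^ 2 := by
        rw [he', div_self hR.ne']
        nlinarith [mul_le_mul_of_nonneg_left hsR hs0]
      have h4 := mul_le_mul_of_nonneg_left h3 hm
      linarith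
    · have hs00 : s = 0 := by
        rw [hUo.frontier_eq] at hy
        by_contra h
        exact hy.2 ⟨⟨lt_of_le_of_ne hy1 (Ne.symm he), lt_of_le_of_ne hy2 he'⟩,
          lt_of_le_of_ne hyn (Ne.symm h)⟩
      have hQy : Q y = y := by
        refine Submodule.reflection_mem_subspace_eq_self ?_
        rw [Submodule.mem_orthogonal_singleton_iff_inner_right]
        rw [hs, hn, real_inner_smul_left] at hs00
        exact (mul_eq_zero.1 hs00).resolve_left (inv_ne_zero hdn.ne')
      rw [hQy, sub_self]
      positivity

/-- Near the inner circle, such a harmonic function is nearly `a + β log (‖y‖ / ε)`. -/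
lemma abs_sub_log_le_of_harmonic_annulus {ε ρ R a κ m : ℝ} (hε : 0 < ε) (hερ : ε < ρ)
    (hρR : ρ < R) {w : E2 → ℝ}
    (hw : HarmonicContOnCl w (annulus ε R)) (hin : ∀ y, ‖y‖ = ε → |w y - a| ≤ κ)
    (hout : ∀ y, ‖y‖ = R → 0 ≤ w y ∧ w y ≤ m) {p : E2} (hp : ‖p‖ = ρ)
    {y : E2} (hy : y ∈ annulus ε ρ) :
    |w y - (a + (w p - a) / Real.log (ρ / ε) * Real.log (‖y‖ / ε))|
      ≤ 2 * κ + 3 * m * (ρ / R) := by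
  have hρ : 0 < ρ := hε.trans hερ
  have hR : 0 < R := hρ.trans hρR
  obtain ⟨p₁, hp₁⟩ := exists_norm_eq E2 hR.le
  obtain ⟨p', hp'⟩ := exists_norm_eq E2 hε.le
  have hm : 0 ≤ m := (hout p₁ hp₁).1.trans (hout p₁ hp₁).2
  have hκ : 0 ≤ κ := (abs_nonneg _).trans (hin p' hp')
  set N := 2 * κ + 3 * m * (ρ / R) with hN
  have hNκ : κ ≤ N := by
    have : 0 ≤ 3 * m * (ρ / R) := by positivity
    linarith
  have hlog : 0 < Real.log (ρ / ε) := Real.log_pos ((one_lt_div hε).2 hερ)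
  set β := (w p - a) / Real.log (ρ / ε) with hβ
  have hne : ∀ y ∈ closure (annulus ε ρ), y ≠ 0 := fun y hy => by
    rw [← norm_pos_iff]; exact hε.trans_le (norm_mem_of_mem_closure_annulus hy).1
  have hg : ∀ c : ℝ, HarmonicContOnCl
      (fun y : E2 => (a + c - β * Real.log ε) + β * Real.log ‖y‖) (annulus ε ρ) :=
    fun c => harmonicContOnCl_log_norm hne _ _
  have hw' := hw.mono (annulus_subset_annulus hρR.le)
  have hexp : ∀ y ∈ closure (annulus ε ρ), β * Real.log (‖y‖ / ε)
      = β * Real.log ‖y‖ - β * Real.log ε := fun y hy => by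
    rw [Real.log_div (norm_ne_zero_iff.2 (hne y hy)) hε.ne', mul_sub]
  have hbd : ∀ y ∈ frontier (annulus ε ρ),
      |w y - (a + β * Real.log (‖y‖ / ε))| ≤ N := by
    intro y hy
    rcases norm_eq_of_mem_frontier_annulus hy with h | h
    · rw [h, div_self hε.ne', Real.log_one, mul_zero, add_zero]
      exact (hin y h).trans hNκ
    · rw [h, hβ, div_mul_cancel₀ _ hlog.ne']
      have hyR : y ∈ annulus ε R := ⟨h ▸ hερ, h ▸ hρR⟩
      have hpR : p ∈ annulus ε R := ⟨hp ▸ hερ, hp ▸ hρR⟩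
      have h1 := sub_le_of_harmonic_annulus hε hw hin hout hyR (h.trans hp.symm)
      have h2 := sub_le_of_harmonic_annulus hε hw hin hout hpR (hp.trans h.symm)
      rw [h] at h1
      rw [hp] at h2
      rw [abs_le]
      constructor <;> linarith
  have hycl := hexp y (subset_closure hy)
  have hup := le_of_le_on_frontier₂ (isOpen_annulus ε ρ) (isBounded_annulus ε ρ) hw' (hg N)
    (fun z hz => by
      have h1 := (abs_le.1 (hbd z hz)).2
      rw [hexp z (frontier_subset_closure hz)] at h1
      linarith) hy
  have hlo := le_of_le_on_frontier₂ (isOpen_annulus ε ρ) (isBounded_annulus ε ρ) (hg (-N)) hw'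
    (fun z hz => by
      have h1 := (abs_le.1 (hbd z hz)).1
      rw [hexp z (frontier_subset_closure hz)] at h1
      linarith) hy
  rw [hycl, abs_le]
  constructor <;> linarith

/-- Logarithmic upper bound for a harmonic function vanishing on the outer boundary. -/
lemma nonneg_and_le_log_of_harmonic {U : Set E2} (hU : IsOpen U) {ε D a : ℝ} (hε : 0 < ε)
    (hεD : ε < D) (ha : 0 ≤ a) (hcl : ∀ y ∈ closure U, ε ≤ ‖y‖ ∧ ‖y‖ ≤ D) {w : E2 → ℝ}
    (hw : HarmonicContOnCl w U)
    (hfr : ∀ y ∈ frontier U, w y = 0 ∨ (‖y‖ = ε ∧ 0 ≤ w y ∧ w y ≤ a)) {y : E2} (hy : y ∈ U) :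
    0 ≤ w y ∧ w y ≤ a * Real.log (D / ‖y‖) / Real.log (D / ε) := by
  have hD : 0 < D := hε.trans hεD
  have hUb : Bornology.IsBounded U := (isBounded_closedBall (x := (0 : E2)) (r := D)).subset
    fun y hy => by simpa using (hcl y (subset_closure hy)).2
  have hne : ∀ y ∈ closure U, y ≠ 0 := fun y hy => by
    rw [← norm_pos_iff]; exact hε.trans_le (hcl y hy).1
  have hlog : 0 < Real.log (D / ε) := Real.log_pos ((one_lt_div hε).2 hεD)
  set c := a / Real.log (D / ε) with hc
  have hc0 : 0 ≤ c := by positivity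
  have hexp : ∀ y ∈ closure U, a * Real.log (D / ‖y‖) / Real.log (D / ε)
      = c * Real.log D + (-c) * Real.log ‖y‖ := fun y hy => by
    rw [Real.log_div hD.ne' (norm_ne_zero_iff.2 (hne y hy)), hc]; ring
  constructor
  · refine le_of_le_on_frontier₂ hU hUb harmonicContOnCl_const hw (v := fun _ => 0)
      (fun z hz => ?_) hy
    rcases hfr z hz with h | h
    · exact h.ge
    · exact h.2.1
  · rw [hexp y (subset_closure hy)]
    refine le_of_le_on_frontier₂ hU hUb hw
      (harmonicContOnCl_log_norm hne (c * Real.log D) (-c)) (fun z hz => ?_) hy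
    have hzc := frontier_subset_closure hz
    rw [← hexp z hzc]
    rcases hfr z hz with h | h
    · rw [h]
      have hz0 : 0 < ‖z‖ := norm_pos_iff.2 (hne z hzc)
      have : 0 ≤ Real.log (D / ‖z‖) := Real.log_nonneg ((one_le_div hz0).2 (hcl z hzc).2)
      positivity
    · rw [h.1, mul_div_cancel_right₀ _ hlog.ne']
      exact h.2.2

end Annulus

section SecondOrder

open InnerProductSpace Laplacian

/-- Second order Taylor expansion at a critical point. -/
lemma eventually_taylor_two {E : Type*} [NormedAddCommGroup E] [NormedSpace ℝ E] {f : E → ℝ}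
    {x : E} (hf : ContDiffAt ℝ 2 f x) (hx : fderiv ℝ f x = 0) {θ : ℝ} (hθ : 0 < θ) :
    ∀ᶠ y in 𝓝 (0 : E),
      |f (y + x) - f x - fderiv ℝ (fderiv ℝ f) x y y / 2| ≤ θ * ‖y‖ ^ 2 := by
  set B := fderiv ℝ (fderiv ℝ f) x with hB
  have hsymm : IsSymmSndFDerivAt ℝ f x := hf.isSymmSndFDerivAt (by simp)
  have hd : HasFDerivAt (fderiv ℝ f) B x :=
    ((hf.fderiv_right (m := 1) (by norm_num)).differentiableAt (by simp)).hasFDerivAt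
  have hlo : ∀ᶠ y in 𝓝 (0 : E), ‖fderiv ℝ f (y + x) - B y‖ ≤ θ * ‖y‖ := by
    have := (hasFDerivAt_iff_isLittleO_nhds_zero.1 hd).def hθ
    filter_upwards [this] with y hy
    simpa [hx, add_comm x y] using hy
  have hsh : Tendsto (fun y : E => y + x) (𝓝 0) (𝓝 x) := by
    have h : Continuous fun y : E => y + x := by fun_prop
    simpa using h.tendsto 0
  have hdf : ∀ᶠ y in 𝓝 (0 : E), DifferentiableAt ℝ f (y + x) :=
    hsh.eventually ((hf.eventually (by simp)).mono fun z hz => hz.differentiableAt (by simp))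
  obtain ⟨r, hr, hball⟩ := Metric.eventually_nhds_iff_ball.1 (hlo.and hdf)
  filter_upwards [ball_mem_nhds (0 : E) hr] with y hy
  have hyr : ‖y‖ < r := by simpa using hy
  set g : E → ℝ := fun z => f (z + x) - B z z / 2 with hg
  have hderiv : ∀ z ∈ closedBall (0 : E) ‖y‖,
      HasFDerivWithinAt g (fderiv ℝ f (z + x) - B z) (closedBall 0 ‖y‖) z := by
    intro z hz
    have hzr : z ∈ ball (0 : E) r := by
      have : ‖z‖ ≤ ‖y‖ := by simpa using hz
      simpa using this.trans_lt hyr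
    have h1 : HasFDerivAt (fun z => f (z + x)) (fderiv ℝ f (z + x)) z := by
      exact (hball z hzr).2.hasFDerivAt.comp z ((hasFDerivAt_id (𝕜 := ℝ) z).add_const x)
    have h2 := (B.hasFDerivAt (x := z)).clm_apply (hasFDerivAt_id (𝕜 := ℝ) z)
    simp only [id] at h2
    have h3 := (h1.sub (h2.const_mul (1 / 2))).hasFDerivWithinAt (s := closedBall 0 ‖y‖)
    have h4 : (fderiv ℝ f (z + x) - B z) = fderiv ℝ f (z + x) -
        (1 / 2 : ℝ) • ((B z).comp (ContinuousLinearMap.id ℝ E) + B.flip z) := by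
      ext v
      have : B v z = B z v := hsymm.eq v z
      simp [this]
      ring
    rw [h4]
    refine h3.congr (fun w _ => ?_) ?_ <;> simp only [hg, Pi.sub_apply] <;> ring
  have hbound : ∀ z ∈ closedBall (0 : E) ‖y‖, ‖fderiv ℝ f (z + x) - B z‖ ≤ θ * ‖y‖ := by
    intro z hz
    have hzy : ‖z‖ ≤ ‖y‖ := by simpa using hz
    have hzr : z ∈ ball (0 : E) r := by simpa using hzy.trans_lt hyr
    exact (hball z hzr).1.trans (by gcongr)
  have := (convex_closedBall (0 : E) ‖y‖).norm_image_sub_le_of_norm_hasFDerivWithin_le hderiv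
    hbound (x := 0) (y := y) (by simp) (by simp)
  simp only [hg, zero_add, map_zero, zero_div, sub_zero, Real.norm_eq_abs] at this
  calc _ = |f (y + x) - B y y / 2 - f x| := by congr 1; ring
    _ ≤ θ * ‖y‖ * ‖y‖ := this
    _ = _ := by ring

lemma hess_apply {u : E2 → ℝ} {x : E2} (hu : ContDiffAt ℝ 2 u x) (i j : Fin 2) :
    Hess u x i j = fderiv ℝ (fderiv ℝ u) x (EuclideanSpace.single i 1)
      (EuclideanSpace.single j 1) := by
  have hd : DifferentiableAt ℝ (fderiv ℝ u) x :=
    (hu.fderiv_right (m := 1) (by norm_num)).differentiableAt (by simp)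
  have := (hd.hasFDerivAt.clm_apply
    (hasFDerivAt_const (EuclideanSpace.single j (1 : ℝ)) x)).fderiv
  simp [Hess, pd2, this]

lemma hess_symm {u : E2 → ℝ} {x : E2} (hu : ContDiffAt ℝ 2 u x) :
    Hess u x 1 0 = Hess u x 0 1 := by
  rw [hess_apply hu, hess_apply hu]
  exact (hu.isSymmSndFDerivAt (by simp) : IsSymmSndFDerivAt ℝ u x).eq _ _

lemma lap_eq_laplacian {u : E2 → ℝ} {x : E2} (hu : ContDiffAt ℝ 2 u x) : lap u x = Δ u x := by
  rw [laplacian_eq_sum_fderiv_fderiv _ (EuclideanSpace.basisFun (Fin 2) ℝ)]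
  have h := hess_apply hu
  simp only [Hess, Matrix.of_apply] at h
  simp [lap, h, Fin.sum_univ_two]

lemma fderiv_fderiv_apply_self {u : E2 → ℝ} {x : E2} (hu : ContDiffAt ℝ 2 u x) (y : E2) :
    fderiv ℝ (fderiv ℝ u) x y y = Hess u x 0 0 * y 0 ^ 2 + 2 * Hess u x 0 1 * (y 0 * y 1)
      + Hess u x 1 1 * y 1 ^ 2 := by
  have hy : y = y 0 • EuclideanSpace.single 0 (1 : ℝ) + y 1 • EuclideanSpace.single 1 (1 : ℝ) := by
    ext i; fin_cases i <;> simp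
  have hs := hess_symm hu
  rw [hess_apply hu, hess_apply hu] at hs
  conv_lhs => rw [hy]
  simp only [map_add, map_smul, add_apply, smul_apply, smul_eq_mul, hess_apply hu, hs]
  ring

end SecondOrder

section Torsion

open InnerProductSpace Laplacian

/-- The difference of the two torsion functions, centred at `x₀`, is harmonic in the perforated
domain, vanishes on the outer boundary and equals `u₀` on the inner circle. -/
lemma torsion_sub_harmonic {Ω : Set E2} (hΩo : IsOpen Ω) {u₀ u : E2 → ℝ} (h₀ : IsTorsion Ω u₀)
    {x₀ : E2} {ε : ℝ} (hε : 0 < ε) (hball : closedBall x₀ ε ⊆ Ω)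
    (hu : IsTorsion (Ω \ closedBall x₀ ε) u) :
    HarmonicContOnCl (fun y => u₀ (y + x₀) - u (y + x₀))
      ((fun y => y + x₀) ⁻¹' (Ω \ closedBall x₀ ε)) ∧
    (∀ y ∈ frontier ((fun y => y + x₀) ⁻¹' (Ω \ closedBall x₀ ε)),
      u₀ (y + x₀) - u (y + x₀) = 0 ∨ ‖y‖ = ε) ∧
    (∀ y, ‖y‖ = ε → u₀ (y + x₀) - u (y + x₀) = u₀ (y + x₀)) := by
  have hVo : IsOpen (Ω \ closedBall x₀ ε) := hΩo.sdiff isClosed_closedBall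
  refine ⟨?_, ?_, ?_⟩
  · have hV : HarmonicContOnCl (fun z => u₀ z - u z) (Ω \ closedBall x₀ ε) := by
      refine ⟨fun z hz => ⟨(h₀.2.1 z hz.1).sub (hu.2.1 z hz), ?_⟩,
        (h₀.1.mono (closure_mono sdiff_subset)).sub hu.1⟩
      filter_upwards [hVo.mem_nhds hz] with y hy
      have h1 := h₀.2.1 y hy.1
      have h2 := hu.2.1 y hy
      have := h1.laplacian_sub h2
      rw [← lap_eq_laplacian h1, ← lap_eq_laplacian h2, h₀.2.2.1 y hy.1, hu.2.2.1 y hy,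
        sub_self] at this
      exact this
    exact harmonicContOnCl_comp_isometry_add (LinearIsometryEquiv.refl ℝ E2) x₀ hV
      (fun y hy => hy)
  · intro y hy
    have hy' : y + x₀ ∈ frontier (Ω \ closedBall x₀ ε) := by
      have := (Homeomorph.addRight x₀).preimage_frontier (Ω \ closedBall x₀ ε)
      exact (this.symm ▸ hy : y ∈ (Homeomorph.addRight x₀) ⁻¹' frontier (Ω \ closedBall x₀ ε))
    have hu0 := hu.2.2.2 _ hy'
    rw [hVo.frontier_eq] at hy'
    by_cases hyΩ : y + x₀ ∈ Ω
    · right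
      have h1 : ‖y‖ ≤ ε := by
        by_contra h
        exact hy'.2 ⟨hyΩ, by simpa using h⟩
      have h2 : ε ≤ ‖y‖ := by
        have hsub : Ω \ closedBall x₀ ε ⊆ (ball x₀ ε)ᶜ := fun z hz hz' =>
          hz.2 (ball_subset_closedBall hz')
        have := closure_minimal hsub isOpen_ball.isClosed_compl hy'.1
        simpa using this
      exact le_antisymm h1 h2
    · left
      have : y + x₀ ∈ frontier Ω := by
        rw [hΩo.frontier_eq]
        exact ⟨closure_mono sdiff_subset hy'.1, hyΩ⟩
      rw [h₀.2.2.2 _ this, hu0, sub_zero]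
  · intro y hy
    have hz : y + x₀ ∈ closedBall x₀ ε := by simp [hy]
    have hzf : y + x₀ ∈ closure (closedBall x₀ ε)ᶜ := by
      have : y + x₀ ∈ frontier (closedBall x₀ ε) := by
        rw [frontier_closedBall x₀ hε.ne']; simp [hy]
      rw [← frontier_compl] at this
      exact frontier_subset_closure this
    have : y + x₀ ∈ frontier (Ω \ closedBall x₀ ε) := by
      rw [hVo.frontier_eq]
      exact ⟨hΩo.inter_closure ⟨hball hz, hzf⟩, fun h => h.2 hz⟩
    rw [hu.2.2.2 _ this, sub_zero]

end Torsion

section Asymptotics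

open InnerProductSpace

lemma tendsto_neg_log_nhdsGT_zero : Tendsto (fun ε => -Real.log ε) (𝓝[>] (0 : ℝ)) atTop :=
  tendsto_neg_atBot_atTop.comp Real.tendsto_log_nhdsGT_zero

lemma tendsto_sq_mul_neg_log_nhdsGT_zero :
    Tendsto (fun ε => ε ^ 2 * -Real.log ε) (𝓝[>] (0 : ℝ)) (𝓝 0) := by
  have := (tendsto_log_mul_rpow_nhdsGT_zero (r := 2) (by norm_num)).neg
  simpa [mul_comm] using this

/-- A family of harmonic functions on `ε < ‖y‖ < R` that is close to `a` on the inner circle and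
logarithmically small away from it behaves, up to constants and after multiplication by `|log ε|`,
like `-b log ‖y‖` with `b` close to `a`, uniformly on a smaller annulus. -/
lemma exists_eventually_log_profile {a C D R : ℝ} (ha : 0 < a) (hR : 0 < R) (hRD : R < D)
    (hD : 1 ≤ D) {W : ℝ → E2 → ℝ}
    (hW : ∀ᶠ ε in 𝓝[>] (0 : ℝ), HarmonicContOnCl (W ε) (annulus ε R) ∧
      (∀ y, ‖y‖ = ε → |W ε y - a| ≤ C * ε ^ 2) ∧
      (∀ y, ε < ‖y‖ → ‖y‖ ≤ R →
        0 ≤ W ε y ∧ W ε y ≤ a * Real.log (D / ‖y‖) / Real.log (D / ε)))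
    {η : ℝ} (hη : 0 < η) :
    ∃ ρ, 0 < ρ ∧ ∀ᶠ ε in 𝓝[>] (0 : ℝ), ∃ b, |b - a| ≤ η ∧
      ∀ y ∈ annulus ε ρ, ∀ y' ∈ annulus ε ρ,
        |-Real.log ε * (W ε y - W ε y') + b * (Real.log ‖y‖ - Real.log ‖y'‖)| ≤ η := by
  have hD0 : 0 < D := by linarith
  set K := 6 * (a * Real.log (D / R)) / R with hK
  have hK0 : 0 < K := by
    have : 0 < Real.log (D / R) := Real.log_pos (by rwa [one_lt_div hR])
    positivity
  obtain ⟨ρ, hρ0, hρ⟩ : ∃ ρ, 0 < ρ ∧ ρ < min R (η / 2 / K) := exists_between (by positivity)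
  have hρR : ρ < R := hρ.trans_le (min_le_left _ _)
  have hρK : K * ρ ≤ η / 2 := by
    have := (lt_div_iff₀ hK0).1 (hρ.trans_le (min_le_right _ _)); linarith
  set p : E2 := ρ • EuclideanSpace.single 0 1 with hp
  have hpn : ‖p‖ = ρ := by simp [hp, norm_smul, abs_of_pos hρ0]
  have hL := tendsto_neg_log_nhdsGT_zero
  have hDε : Tendsto (fun ε => Real.log (D / ε)) (𝓝[>] (0 : ℝ)) atTop := by
    refine (tendsto_atTop_add_const_left _ (Real.log D) hL).congr' ?_
    filter_upwards [self_mem_nhdsWithin] with ε hε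
    rw [Real.log_div hD0.ne' (ne_of_gt hε)]; ring
  have hpos : ∀ᶠ ε in 𝓝[>] (0 : ℝ), 0 < ε := self_mem_nhdsWithin
  have hlt : ∀ c : ℝ, 0 < c → ∀ᶠ ε in 𝓝[>] (0 : ℝ), ε < c := fun c hc =>
    mem_nhdsWithin_of_mem_nhds (gt_mem_nhds hc)
  have hWp : Tendsto (fun ε => W ε p) (𝓝[>] (0 : ℝ)) (𝓝 0) := by
    refine tendsto_of_tendsto_of_tendsto_of_le_of_le' tendsto_const_nhds
      (hDε.const_div_atTop (a * Real.log (D / ρ))) ?_ ?_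
    · filter_upwards [hW, hlt ρ hρ0] with ε h1 h2
      exact (h1.2.2 p (by rwa [hpn]) (by rw [hpn]; exact hρR.le)).1
    · filter_upwards [hW, hlt ρ hρ0] with ε h1 h2
      have := (h1.2.2 p (by rwa [hpn]) (by rw [hpn]; exact hρR.le)).2
      rwa [hpn] at this
  have hratio : Tendsto (fun ε => -Real.log ε / Real.log (ρ / ε)) (𝓝[>] (0 : ℝ)) (𝓝 1) := by
    have h1 : Tendsto (fun ε => 1 + Real.log ρ / -Real.log ε) (𝓝[>] (0 : ℝ)) (𝓝 1) := by
      simpa using (hL.const_div_atTop (Real.log ρ)).const_add 1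
    have h2 := h1.inv₀ one_ne_zero
    rw [inv_one] at h2
    refine h2.congr' ?_
    filter_upwards [hpos, hL.eventually_gt_atTop 0] with ε hε hl
    rw [Real.log_div hρ0.ne' hε.ne', ← inv_div (Real.log ρ - Real.log ε)]
    have hl' : Real.log ε ≠ 0 := (neg_pos.1 hl).ne
    congr 1
    field_simp
    ring
  have hb : Tendsto (fun ε => (a - W ε p) * (-Real.log ε / Real.log (ρ / ε)))
      (𝓝[>] (0 : ℝ)) (𝓝 a) := by
    simpa using (hWp.const_sub a).mul hratio
  have hC : Tendsto (fun ε => 4 * C * (ε ^ 2 * -Real.log ε)) (𝓝[>] (0 : ℝ)) (𝓝 0) := by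
    simpa using tendsto_sq_mul_neg_log_nhdsGT_zero.const_mul (4 * C)
  refine ⟨ρ, hρ0, ?_⟩
  filter_upwards [hW, hpos, hlt ρ hρ0, hL.eventually_gt_atTop 0,
    hC.eventually (gt_mem_nhds (half_pos hη)), hb.eventually (closedBall_mem_nhds a hη)]
    with ε ⟨hWh, hWin, hWb⟩ hε hερ hl hCε hbε
  refine ⟨_, hbε, fun y hy y' hy' => ?_⟩
  set m := a * Real.log (D / R) / Real.log (D / ε) with hm
  have hout : ∀ y, ‖y‖ = R → 0 ≤ W ε y ∧ W ε y ≤ m := fun y hy => by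
    have := hWb y (by rw [hy]; exact hερ.trans hρR) hy.le
    rwa [hy] at this
  have hLm : -Real.log ε * m ≤ a * Real.log (D / R) := by
    have h1 : -Real.log ε ≤ Real.log (D / ε) := by
      rw [Real.log_div hD0.ne' hε.ne']
      linarith [Real.log_nonneg hD]
    rw [hm, mul_div_assoc', div_le_iff₀ (hl.trans_le h1), mul_comm]
    gcongr
    have : 0 < Real.log (D / R) := Real.log_pos (by rwa [one_lt_div hR])
    positivity
  have h1 := abs_sub_log_le_of_harmonic_annulus hε hερ hρR hWh hWin hout hpn hy
  have h2 := abs_sub_log_le_of_harmonic_annulus hε hερ hρR hWh hWin hout hpn hy'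
  have hy0 : 0 < ‖y‖ := hε.trans hy.1
  have hy0' : 0 < ‖y'‖ := hε.trans hy'.1
  rw [Real.log_div hy0.ne' hε.ne'] at h1
  rw [Real.log_div hy0'.ne' hε.ne'] at h2
  set q := (W ε p - a) / Real.log (ρ / ε) with hq
  have h3 : -Real.log ε * (W ε y - W ε y') +
      (a - W ε p) * (-Real.log ε / Real.log (ρ / ε)) * (Real.log ‖y‖ - Real.log ‖y'‖) =
      -Real.log ε * ((W ε y - (a + q * (Real.log ‖y‖ - Real.log ε))) -
        (W ε y' - (a + q * (Real.log ‖y'‖ - Real.log ε)))) := by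
    rw [hq]; ring
  rw [h3, abs_mul, abs_of_pos hl]
  calc _ ≤ -Real.log ε * (2 * (2 * (C * ε ^ 2) + 3 * m * (ρ / R))) := by
        gcongr
        refine (abs_sub _ _).trans ?_
        linarith
    _ = 4 * C * (ε ^ 2 * -Real.log ε) + 6 * (ρ / R) * (-Real.log ε * m) := by ring
    _ ≤ 4 * C * (ε ^ 2 * -Real.log ε) + 6 * (ρ / R) * (a * Real.log (D / R)) := by gcongr
    _ = 4 * C * (ε ^ 2 * -Real.log ε) + K * ρ := by rw [hK]; ring
    _ ≤ η := by linarith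

end Asymptotics

section Location

open InnerProductSpace

/-- Quantitative strict minimality of `t - 1 - log t` at `t = 1`, in filter form. -/
lemma tendsto_of_le_mul_one_add_abs_log {ι : Type*} {l : Filter ι} {t q : ι → ℝ} {a C : ℝ}
    (ha : 0 < a) (hC : 0 ≤ C) (ht : ∀ᶠ i in l, 0 < t i) (hq : ∀ᶠ i in l, 0 ≤ q i)
    (h : ∀ η > 0, ∀ᶠ i in l, a / 2 * (t i - 1 - Real.log (t i)) + q i / 2 ≤
      η * (1 + |Real.log (t i)| / 2 + C * (t i + 1))) :
    Tendsto t l (𝓝 1) ∧ Tendsto q l (𝓝 0) := by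
  set K := 2 + 3 * C with hK
  have hK0 : 0 < K := by positivity
  have key : ∀ δ > 0, ∀ᶠ i in l, 0 < t i ∧ 0 ≤ q i ∧ t i - 1 - Real.log (t i) ≤ δ ∧ q i ≤ δ := by
    intro δ hδ
    set κ := min (a / 4) (min (a / 4 * δ) (δ / 2)) with hκ
    have hκ0 : 0 < κ := by positivity
    filter_upwards [ht, hq, h (κ / K) (by positivity)] with i hti hqi hi
    set φ := t i - 1 - Real.log (t i) with hφ
    have h0 : 0 ≤ φ := by linarith [Real.log_le_sub_one_of_pos hti]
    have h1 : t i ≤ 2 * φ + 2 := by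
      have h2 := Real.log_le_sub_one_of_pos (half_pos hti)
      rw [Real.log_div hti.ne' two_ne_zero] at h2
      have := Real.log_two_lt_d9
      linarith
    have h2 : |Real.log (t i)| ≤ 2 * φ + 2 := by
      rw [abs_le]; constructor <;> linarith [Real.log_le_sub_one_of_pos hti]
    have h3 : 1 + |Real.log (t i)| / 2 + C * (t i + 1) ≤ K * (1 + φ) := by
      have : C * (t i + 1) ≤ C * (2 * φ + 3) := 
        mul_le_mul_of_nonneg_left (by linarith) hC
      have : 0 ≤ C * φ := by positivity
      rw [hK]; linarith
    have h4 : a / 2 * φ + q i / 2 ≤ κ * (1 + φ) := by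
      refine hi.trans ((mul_le_mul_of_nonneg_left h3 (by positivity)).trans_eq ?_)
      field_simp
    have h5 : κ * φ ≤ a / 4 * φ := by gcongr; exact min_le_left _ _
    have h6 : κ ≤ a / 4 * δ := (min_le_right _ _).trans (min_le_left _ _)
    have h7 : κ ≤ δ / 2 := (min_le_right _ _).trans (min_le_right _ _)
    have h8 : 0 ≤ a / 4 * φ := by positivity
    refine ⟨hti, hqi, le_of_mul_le_mul_left (a := a / 4) ?_ (by positivity), ?_⟩ <;> linarith
  constructor
  · have hsq : Tendsto (fun i => (√(t i) - 1) ^ 2) l (𝓝 0) := by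
      rw [Metric.tendsto_nhds]
      intro δ hδ
      filter_upwards [key (δ / 2) (by positivity)] with i ⟨hti, _, hi, _⟩
      have hs := Real.sqrt_pos.2 hti
      have h1 := Real.log_le_sub_one_of_pos hs
      rw [Real.log_sqrt hti.le] at h1
      have h2 := Real.sq_sqrt hti.le
      rw [Real.dist_0_eq_abs, abs_of_nonneg (sq_nonneg _)]
      nlinarith
    have hs : Tendsto (fun i => √(t i) - 1) l (𝓝 0) := by
      rw [tendsto_zero_iff_abs_tendsto_zero]
      simpa [Real.sqrt_sq_eq_abs, Function.comp_def] using hsq.sqrt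
    have := (hs.add_const 1).pow 2
    refine (this.congr' ?_).trans (by simp)
    filter_upwards [ht] with i hi
    simp [Real.sq_sqrt hi.le]
  · rw [Metric.tendsto_nhds]
    intro δ hδ
    filter_upwards [key (δ / 2) (by positivity)] with i ⟨_, hqi, _, hi⟩
    rw [Real.dist_0_eq_abs, abs_of_nonneg hqi]
    linarith

/-- A symmetric `2 × 2` matrix `(p, r; r, s)` with eigenvalues `l₁, l₂` and its largest
eigenvalue. -/
lemma sub_max_eigenvalue_form {p r s l₁ l₂ : ℝ} (htr : p + s = l₁ + l₂)
    (hdet : p * s - r * r = l₁ * l₂) :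
    (∃ x y : ℝ, x ^ 2 + y ^ 2 ≠ 0 ∧
      p * x ^ 2 + 2 * r * (x * y) + s * y ^ 2 = max l₁ l₂ * (x ^ 2 + y ^ 2)) ∧
    ∀ x y : ℝ, p * x ^ 2 + 2 * r * (x * y) + s * y ^ 2 ≤ max l₁ l₂ * (x ^ 2 + y ^ 2) ∧
      (p * x + r * y - max l₁ l₂ * x) ^ 2 + (r * x + s * y - max l₁ l₂ * y) ^ 2 =
        (2 * max l₁ l₂ - (l₁ + l₂)) *
          (max l₁ l₂ * (x ^ 2 + y ^ 2) - (p * x ^ 2 + 2 * r * (x * y) + s * y ^ 2)) := by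
  set m := max l₁ l₂ with hm
  have hT : 0 ≤ 2 * m - (l₁ + l₂) := by
    linarith [le_max_left l₁ l₂, le_max_right l₁ l₂]
  have hchar : (m - p) * (m - s) = r * r := by
    have : (m - l₁) * (m - l₂) = 0 := by
      rcases max_choice l₁ l₂ with h | h <;> rw [← hm] at h <;> rw [h] <;> ring
    linear_combination this + hdet - m * htr
  have hnorm : ∀ x y : ℝ,
      (p * x + r * y - m * x) ^ 2 + (r * x + s * y - m * y) ^ 2 =
        (2 * m - (l₁ + l₂)) *
          (m * (x ^ 2 + y ^ 2) - (p * x ^ 2 + 2 * r * (x * y) + s * y ^ 2)) := by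
    intro x y
    rw [← htr]
    linear_combination -(x ^ 2 + y ^ 2) * hchar
  have hp : 0 ≤ m - p := by
    by_contra! h
    nlinarith [mul_self_nonneg r]
  have hs : 0 ≤ m - s := by
    by_contra! h
    nlinarith [mul_self_nonneg r]
  refine ⟨?_, fun x y => ⟨?_, hnorm x y⟩⟩
  · rcases hp.eq_or_lt with h | h
    · exact ⟨1, 0, by norm_num, by linarith⟩
    · exact ⟨r, m - p, by positivity, by linear_combination -(m - p) * hchar⟩
  · rcases hT.eq_or_lt with h | h
    · have h1 : m - p = 0 := by linarith
      have h2 : m - s = 0 := by linarith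
      have h3 : r = 0 := by rw [h1, zero_mul] at hchar; exact mul_self_eq_zero.1 hchar.symm
      rw [h3]
      nlinarith
    · have := hnorm x y
      have h1 : 0 ≤ (2 * m - (l₁ + l₂)) *
          (m * (x ^ 2 + y ^ 2) - (p * x ^ 2 + 2 * r * (x * y) + s * y ^ 2)) := by
        rw [← this]; positivity
      linarith [nonneg_of_mul_nonneg_right h1 h]

/-- Maximizing sequences converge to a strict global maximum point. -/
lemma tendsto_of_tendsto_max {X ι : Type*} [TopologicalSpace X] {K : Set X} (hK : IsCompact K)
    {f : X → ℝ} (hf : ContinuousOn f K) {x₀ : X} (hlt : ∀ z ∈ K, z ≠ x₀ → f z < f x₀)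
    {l : Filter ι} {x : ι → X} (hx : ∀ᶠ i in l, x i ∈ K)
    (hlim : ∀ c < f x₀, ∀ᶠ i in l, c < f (x i)) : Tendsto x l (𝓝 x₀) := by
  rw [_root_.tendsto_nhds]
  intro V hV hxV
  rcases (K \ V).eq_empty_or_nonempty with h | h
  · filter_upwards [hx] with i hi
    by_contra hn
    exact (h ▸ (⟨hi, hn⟩ : x i ∈ K \ V) : x i ∈ (∅ : Set X))
  · obtain ⟨z, hz, hmax⟩ := (hK.diff hV).exists_isMaxOn h (hf.mono sdiff_subset)
    filter_upwards [hx, hlim _ (hlt z hz.1 fun h => hz.2 (h ▸ hxV))] with i hi hlti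
    by_contra hn
    exact absurd (hmax ⟨hi, hn⟩) (not_le.2 hlti)

/-- Logarithmic bound for the difference of the two torsion functions. -/
lemma torsion_sub_bounds {Ω : Set E2} (hΩo : IsOpen Ω) {u₀ u : E2 → ℝ} (h₀ : IsTorsion Ω u₀)
    {x₀ : E2} {ε a D : ℝ} (hε : 0 < ε) (hball : closedBall x₀ ε ⊆ Ω)
    (hu : IsTorsion (Ω \ closedBall x₀ ε) u) (ha : 0 ≤ a) (hu₀ : ∀ x ∈ Ω, 0 ≤ u₀ x ∧ u₀ x ≤ a)
    (hεD : ε < D) (hD : Ω ⊆ closedBall x₀ D) {y : E2} (hy : y + x₀ ∈ Ω) (hεy : ε < ‖y‖) :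
    0 ≤ u₀ (y + x₀) - u (y + x₀) ∧
      u₀ (y + x₀) - u (y + x₀) ≤ a * Real.log (D / ‖y‖) / Real.log (D / ε) := by
  obtain ⟨hh, hfr, hin⟩ := torsion_sub_harmonic hΩo h₀ hε hball hu
  have hcont : Continuous fun y : E2 => y + x₀ := by fun_prop
  refine nonneg_and_le_log_of_harmonic ((hΩo.sdiff isClosed_closedBall).preimage hcont) hε hεD ha
    (fun z hz => ?_) hh (fun z hz => ?_) 
    (show y + x₀ ∈ Ω \ closedBall x₀ ε from ⟨hy, by simpa using hεy⟩)
  · have hcl : IsClosed {z : E2 | ε ≤ ‖z‖ ∧ ‖z‖ ≤ D} :=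
      (isClosed_le continuous_const continuous_norm).inter
        (isClosed_le continuous_norm continuous_const)
    refine closure_minimal (t := {z : E2 | ε ≤ ‖z‖ ∧ ‖z‖ ≤ D}) (fun w hw => And.intro ?_ ?_) hcl hz
    · have := hw.2
      simp only [mem_closedBall, dist_eq_norm, add_sub_cancel_right, not_le] at this
      exact this.le
    · simpa using hD hw.1
  · refine (hfr z hz).imp id fun h => ⟨h, ?_⟩
    rw [hin z h]
    exact hu₀ _ (hball (by simp [h]))

lemma norm_sq_eq_two (y : E2) : ‖y‖ ^ 2 = y 0 ^ 2 + y 1 ^ 2 := by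
  simp [EuclideanSpace.real_norm_sq_eq, Fin.sum_univ_two]

/-- If the torsion function has a single critical point, which is its maximum point, then the
maximum is strict on the closed domain. -/
lemma torsion_lt_of_ne {Ω : Set E2} (hΩo : IsOpen Ω) {u₀ : E2 → ℝ} (h₀ : IsTorsion Ω u₀) {x₀ : E2}
    (hpos : 0 < u₀ x₀) (huniq : ∀ x ∈ Ω, gradient u₀ x = 0 → x = x₀)
    (hmax : IsMaxOn u₀ Ω x₀) {z : E2} (hz : z ∈ closure Ω) (hne : z ≠ x₀) : u₀ z < u₀ x₀ := by
  by_cases hzΩ : z ∈ Ω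
  · refine (hmax hzΩ).lt_of_ne fun h => hne (huniq z hzΩ ?_)
    have hloc : IsLocalMax u₀ z := by
      filter_upwards [hΩo.mem_nhds hzΩ] with w hw
      rw [h]; exact hmax hw
    rw [gradient, hloc.fderiv_eq_zero, map_zero]
  · have : z ∈ frontier Ω := by rw [hΩo.frontier_eq]; exact ⟨hz, hzΩ⟩
    rwa [h₀.2.2.2 z this]

/-- Comparing the values of `f - w` at a maximum point `y` and at the point `z` of squared norm
`τ² / L` in the direction of the top eigenvector. -/
lemma log_gap_of_le {a b m L τ η fy fz wy wz Qy Qz ny nz : ℝ} (hL : 0 < L) (hτ : 0 < τ)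
    (hτa : -m * τ ^ 2 = a) (hny : 0 < ny) (hnz : 0 < nz) (hnzL : L * nz ^ 2 = τ ^ 2)
    (hQz : Qz = m * nz ^ 2) (hle : fz - wz ≤ fy - wy)
    (hfy : |fy - a - Qy / 2| ≤ η * ny ^ 2) (hfz : |fz - a - Qz / 2| ≤ η * nz ^ 2)
    (hb : |b - a| ≤ η)
    (hw : |L * (wy - wz) + b * (Real.log ny - Real.log nz)| ≤ η) :
    a / 2 * (L * ny ^ 2 / τ ^ 2 - 1 - Real.log (L * ny ^ 2 / τ ^ 2)) +
      L * (m * ny ^ 2 - Qy) / 2 ≤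
      η * (1 + |Real.log (L * ny ^ 2 / τ ^ 2)| / 2 + τ ^ 2 * (L * ny ^ 2 / τ ^ 2 + 1)) := by
  have ht : L * ny ^ 2 / τ ^ 2 = (ny / nz) ^ 2 := by
    rw [← hnzL]; field_simp
  have hlog : Real.log (L * ny ^ 2 / τ ^ 2) = 2 * (Real.log ny - Real.log nz) := by
    rw [ht, Real.log_pow, Real.log_div hny.ne' hnz.ne']; norm_num
  set t := L * ny ^ 2 / τ ^ 2 with htdef
  have htτ : τ ^ 2 * t = L * ny ^ 2 := by rw [htdef]; field_simp
  have h1 : wy - wz ≤ Qy / 2 - Qz / 2 + η * ny ^ 2 + η * nz ^ 2 := by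
    linarith [(abs_le.1 hfy).2, (abs_le.1 hfz).1]
  have h2 := mul_le_mul_of_nonneg_left h1 hL.le
  have h3 : L * (Qy / 2 - Qz / 2 + η * ny ^ 2 + η * nz ^ 2) =
      L * Qy / 2 + a / 2 + η * (τ ^ 2 * (t + 1)) := by
    rw [hQz, ← hτa]
    linear_combination (-m / 2 + η) * hnzL - η * htτ
  have h4 : L * (m * ny ^ 2) = -a * t := by
    rw [← hτa]; linear_combination -m * htτ
  have h5 : (b - a) * (Real.log t / 2) ≤ η * (|Real.log t| / 2) := by
    refine (le_abs_self _).trans ?_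
    rw [abs_mul, abs_div, abs_two]
    gcongr
  have h7 := (abs_le.1 hw).1
  have h8 : b * (Real.log ny - Real.log nz) = b * (Real.log t / 2) := by rw [hlog]; ring
  linarith

end Location

/-- If `x₀ = y₀`, the maximum points satisfy `|log ε|·|x_ε-x₀|² → -u₀(x₀)/λ` and
`(x_ε-x₀)/|x_ε-x₀|` is asymptotically an eigenvector of `D²u₀(x₀)` for `λ = max{λ₁,λ₂}`. -/
theorem max_point_location_of_eq
    (Ω : Set E2) (hΩo : IsOpen Ω) (hΩb : Bornology.IsBounded Ω) (hΩc : Convex ℝ Ω)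
    (u₀ : E2 → ℝ) (h₀ : IsTorsion Ω u₀) (h₀pos : ∀ x ∈ Ω, 0 < u₀ x)
    (y₀ : E2) (hy₀ : y₀ ∈ Ω) (hy₀crit : gradient u₀ y₀ = 0)
    (hy₀uniq : ∀ x ∈ Ω, gradient u₀ x = 0 → x = y₀)
    (hy₀max : IsMaxOn u₀ Ω y₀)
    (x₀ : E2) (hx₀ : x₀ ∈ Ω) (heq : x₀ = y₀)
    (l₁ l₂ : ℝ) (hl₁ : l₁ < 0) (hl₂ : l₂ < 0)
    (htr : Hess u₀ x₀ 0 0 + Hess u₀ x₀ 1 1 = l₁ + l₂)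
    (hdet : Hess u₀ x₀ 0 0 * Hess u₀ x₀ 1 1 - Hess u₀ x₀ 0 1 * Hess u₀ x₀ 1 0 = l₁ * l₂)
    (ε₁ : ℝ) (hε₁ : 0 < ε₁) (hball : closedBall x₀ ε₁ ⊆ Ω)
    (uε : ℝ → E2 → ℝ) (xε : ℝ → E2)
    (huε : ∀ ε ∈ Ioo (0:ℝ) ε₁, IsTorsion (Ω \ closedBall x₀ ε) (uε ε))
    (hxε : ∀ ε ∈ Ioo (0:ℝ) ε₁, xε ε ∈ Ω \ closedBall x₀ ε ∧
      IsMaxOn (uε ε) (Ω \ closedBall x₀ ε) (xε ε)) :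
    Tendsto (fun ε => |Real.log ε| * ‖xε ε - x₀‖ ^ 2) (𝓝[>] (0:ℝ))
        (𝓝 (-u₀ x₀ / max l₁ l₂)) ∧
    Tendsto (fun ε =>
        vnorm (fun i => (Hess u₀ x₀).mulVec (fun j => (xε ε - x₀) j) i
          - max l₁ l₂ * (xε ε - x₀) i) / ‖xε ε - x₀‖)
      (𝓝[>] (0:ℝ)) (𝓝 0) := by
  subst heq
  set a := u₀ x₀ with ha
  have ha0 : 0 < a := h₀pos x₀ hx₀
  have hreg := h₀.2.1 x₀ hx₀
  have hcrit : fderiv ℝ u₀ x₀ = 0 := (hy₀max.isLocalMax (hΩo.mem_nhds hx₀)).fderiv_eq_zero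
  have hpos : ∀ᶠ ε in 𝓝[>] (0 : ℝ), 0 < ε := self_mem_nhdsWithin
  have hltc : ∀ c : ℝ, 0 < c → ∀ᶠ ε in 𝓝[>] (0 : ℝ), ε < c := fun c hc =>
    mem_nhdsWithin_of_mem_nhds (gt_mem_nhds hc)
  have hL := tendsto_neg_log_nhdsGT_zero
  obtain ⟨D, hDε₁, hD1, hΩD⟩ : ∃ D, ε₁ < D ∧ 1 ≤ D ∧ Ω ⊆ closedBall x₀ D := by
    obtain ⟨D, hD⟩ := hΩb.subset_closedBall x₀
    exact ⟨max D (max (ε₁ + 1) 1), by simp, by simp,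
      hD.trans (closedBall_subset_closedBall (le_max_left _ _))⟩
  set W : ℝ → E2 → ℝ := fun ε y => u₀ (y + x₀) - uε ε (y + x₀) with hWdef
  have hWb : ∀ ε ∈ Ioo (0 : ℝ) ε₁, ∀ y, y + x₀ ∈ Ω → ε < ‖y‖ →
      0 ≤ W ε y ∧ W ε y ≤ a * Real.log (D / ‖y‖) / Real.log (D / ε) := fun ε hε y hy hεy =>
    torsion_sub_bounds hΩo h₀ hε.1 ((closedBall_subset_closedBall hε.2.le).trans hball) (huε ε hε)
      ha0.le (fun x hx => ⟨(h₀pos x hx).le, hy₀max hx⟩) (hε.2.trans hDε₁) hΩD hy hεy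
  have hIoo : ∀ᶠ ε in 𝓝[>] (0 : ℝ), ε ∈ Ioo (0 : ℝ) ε₁ := Ioo_mem_nhdsGT hε₁
  set B := fderiv ℝ (fderiv ℝ u₀) x₀ with hB
  obtain ⟨r, hr, hrT⟩ := Metric.eventually_nhds_iff_ball.1
    (eventually_taylor_two hreg hcrit one_pos)
  have hquad : ∀ y, ‖y‖ < r → |u₀ (y + x₀) - a| ≤ (‖B‖ / 2 + 1) * ‖y‖ ^ 2 := fun y hy => by
    have h1 := hrT y (by simpa using hy)
    have h2 : |B y y| ≤ ‖B‖ * ‖y‖ * ‖y‖ := B.le_opNorm₂ y y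
    have h3 := abs_add_le (u₀ (y + x₀) - a - B y y / 2) (B y y / 2)
    rw [sub_add_cancel, abs_div, abs_two] at h3
    linarith
  have hprofile : ∀ᶠ ε in 𝓝[>] (0 : ℝ),
      InnerProductSpace.HarmonicContOnCl (W ε) (annulus ε ε₁) ∧
      (∀ y, ‖y‖ = ε → |W ε y - a| ≤ (‖B‖ / 2 + 1) * ε ^ 2) ∧
      (∀ y, ε < ‖y‖ → ‖y‖ ≤ ε₁ →
        0 ≤ W ε y ∧ W ε y ≤ a * Real.log (D / ‖y‖) / Real.log (D / ε)) := by
    filter_upwards [hIoo, hltc r hr] with ε hε hεr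
    obtain ⟨hh, -, hin⟩ := torsion_sub_harmonic hΩo h₀ hε.1
      ((closedBall_subset_closedBall hε.2.le).trans hball) (huε ε hε)
    have hmem : ∀ y : E2, ‖y‖ ≤ ε₁ → y + x₀ ∈ Ω := fun y hy => hball (by simpa using hy)
    refine ⟨hh.mono fun y hy => ?_, fun y hy => ?_, fun y h1 h2 => hWb ε hε y (hmem y h2) h1⟩
    · exact (show y + x₀ ∈ Ω \ closedBall x₀ ε from
        ⟨hmem y hy.2.le, by simpa using hy.1⟩)
    · rw [hWdef]
      simp only
      rw [hin y hy, ← hy]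
      exact hquad y (hy.trans_lt hεr)
  have hxconv : Tendsto xε (𝓝[>] (0 : ℝ)) (𝓝 x₀) := by
    refine tendsto_of_tendsto_max (hΩb.isCompact_closure) h₀.1
      (fun z hz hne => torsion_lt_of_ne hΩo h₀ ha0 hy₀uniq hy₀max hz hne) ?_ fun c hc => ?_
    · filter_upwards [hIoo] with ε hε
      exact subset_closure (hxε ε hε).1.1
    · have hev : ∀ᶠ z in 𝓝[≠] x₀, c < u₀ z ∧ z ∈ Ω :=
        mem_nhdsWithin_of_mem_nhds
          ((hreg.continuousAt.eventually (lt_mem_nhds hc)).and (hΩo.mem_nhds hx₀))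
      obtain ⟨z, ⟨hzc, hzΩ⟩, hzne⟩ := (hev.and self_mem_nhdsWithin).exists
      have hzpos : 0 < ‖z - x₀‖ := norm_pos_iff.2 (sub_ne_zero.2 hzne)
      have hDε : Tendsto (fun ε => Real.log (D / ε)) (𝓝[>] (0 : ℝ)) atTop :=
        Real.tendsto_log_atTop.comp
          (tendsto_inv_nhdsGT_zero.const_mul_atTop (zero_lt_one.trans_le hD1))
      have hsmall := (hDε.const_div_atTop (a * Real.log (D / ‖z - x₀‖))).eventually
        (gt_mem_nhds (sub_pos.2 hzc))
      filter_upwards [hIoo, hltc _ hzpos, hsmall] with ε hε hεz hs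
      obtain ⟨hxm, hxmax⟩ := hxε ε hε
      have h1 := (hWb ε hε (z - x₀) (by simpa using hzΩ) hεz).2
      have h2 := (hWb ε hε (xε ε - x₀) (by simpa using hxm.1)
        (by simpa [dist_eq_norm] using hxm.2)).1
      simp only [hWdef, sub_add_cancel] at h1 h2
      have h3 : uε ε z ≤ uε ε (xε ε) :=
        hxmax ⟨hzΩ, by simpa [dist_eq_norm] using hεz⟩
      linarith
  have hY : Tendsto (fun ε => xε ε - x₀) (𝓝[>] (0 : ℝ)) (𝓝 0) := by
    simpa using hxconv.sub_const x₀
  have hQ : ∀ y : E2, B y y = Hess u₀ x₀ 0 0 * y 0 ^ 2 + 2 * Hess u₀ x₀ 0 1 * (y 0 * y 1)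
      + Hess u₀ x₀ 1 1 * y 1 ^ 2 := fun y => fderiv_fderiv_apply_self hreg y
  have hsym := hess_symm hreg
  rw [hsym] at hdet
  obtain ⟨⟨z₀, z₁, hz0, hz⟩, hform⟩ := sub_max_eigenvalue_form htr hdet
  set m := max l₁ l₂ with hm
  have hm0 : m < 0 := max_lt hl₁ hl₂
  obtain ⟨e, he1, heQ⟩ : ∃ e : E2, ‖e‖ = 1 ∧ B e e = m := by
    set z : E2 := !₂[z₀, z₁] with hzdef
    have hzn : ‖z‖ ^ 2 = z₀ ^ 2 + z₁ ^ 2 := by simp [norm_sq_eq_two, hzdef]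
    have hzQ : B z z = m * ‖z‖ ^ 2 := by rw [hQ, hzn, ← hz]; simp [hzdef]
    have hzn0 : ‖z‖ ≠ 0 := fun h => hz0 (by rw [← hzn, h]; norm_num)
    refine ⟨‖z‖⁻¹ • z, by simp [norm_smul, hzn0], ?_⟩
    simp only [map_smul, smul_apply, smul_eq_mul, hzQ]
    field_simp
  set τ := √(a / -m) with hτ
  have hτ0 : 0 < τ := Real.sqrt_pos.2 (div_pos ha0 (neg_pos.2 hm0))
  have hτ2 : τ ^ 2 = a / -m := Real.sq_sqrt (div_pos ha0 (neg_pos.2 hm0)).le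
  have hτa : -m * τ ^ 2 = a := by
    have := hm0.ne
    rw [hτ2]; field_simp
  set s : ℝ → ℝ := fun ε => τ / √(-Real.log ε) with hs
  have hs0 : Tendsto s (𝓝[>] (0 : ℝ)) (𝓝 0) :=
    (Real.tendsto_sqrt_atTop.comp hL).const_div_atTop τ
  have hes : Tendsto (fun ε => s ε • e) (𝓝[>] (0 : ℝ)) (𝓝 0) := by
    simpa using hs0.smul_const e
  have hεs : ∀ᶠ ε in 𝓝[>] (0 : ℝ), ε < s ε := by
    filter_upwards [hpos, hL.eventually_gt_atTop 0,
      tendsto_sq_mul_neg_log_nhdsGT_zero.eventually (gt_mem_nhds (pow_pos hτ0 2))] with ε h1 h2 h3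
    refine lt_of_pow_lt_pow_left₀ 2 (by positivity) ?_
    rw [hs, div_pow, Real.sq_sqrt h2.le, lt_div_iff₀ h2]
    exact h3
  have hYpos : ∀ᶠ ε in 𝓝[>] (0 : ℝ), 0 < ‖xε ε - x₀‖ := by
    filter_upwards [hIoo] with ε hε
    refine hε.1.trans ?_
    simpa [dist_eq_norm] using (hxε ε hε).1.2
  set t : ℝ → ℝ := fun ε => -Real.log ε * ‖xε ε - x₀‖ ^ 2 / τ ^ 2 with ht
  set q : ℝ → ℝ := fun ε =>
    -Real.log ε * (m * ‖xε ε - x₀‖ ^ 2 - B (xε ε - x₀) (xε ε - x₀)) with hq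
  obtain ⟨ht1, hq0⟩ : Tendsto t (𝓝[>] (0 : ℝ)) (𝓝 1) ∧ Tendsto q (𝓝[>] (0 : ℝ)) (𝓝 0) := by
    refine tendsto_of_le_mul_one_add_abs_log ha0 (sq_nonneg τ) ?_ ?_ fun η hη => ?_
    · filter_upwards [hYpos, hL.eventually_gt_atTop 0] with ε h1 h2
      positivity
    · filter_upwards [hL.eventually_gt_atTop 0] with ε h2
      refine mul_nonneg h2.le (sub_nonneg.2 ?_)
      rw [hQ, norm_sq_eq_two]
      exact (hform _ _).1
    · obtain ⟨ρ, hρ0, hρ⟩ := exists_eventually_log_profile ha0 hε₁ hDε₁ hD1 hprofile hη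
      have hT := eventually_taylor_two hreg hcrit hη
      have hbρ := ball_mem_nhds (0 : E2) hρ0
      filter_upwards [hIoo, hρ, hL.eventually_gt_atTop 0, hY.eventually hT, hes.eventually hT,
        hY.eventually hbρ, hes.eventually hbρ, hεs,
        hes.eventually (ball_mem_nhds (0 : E2) hε₁)]
        with ε hε ⟨b, hb, hw⟩ hl hTY hTe hYρ heρ hεse heε₁
      have hes_norm : ‖s ε • e‖ = s ε := by
        rw [norm_smul, he1, mul_one, Real.norm_eq_abs, abs_of_pos (hε.1.trans hεse)]
      obtain ⟨hxm, hxmax⟩ := hxε ε hε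
      have hxn : ε < ‖xε ε - x₀‖ := by simpa [dist_eq_norm] using hxm.2
      rw [dist_zero_right] at hYρ heρ heε₁
      have hne : ε < ‖s ε • e‖ := by rwa [hes_norm]
      have hmx : uε ε (s ε • e + x₀) ≤ uε ε (xε ε) :=
        hxmax ⟨hball (by simpa using heε₁.le), by simpa using hne⟩
      refine log_gap_of_le (nz := ‖s ε • e‖) (wy := W ε (xε ε - x₀)) (wz := W ε (s ε • e)) hl hτ0
        hτa (hε.1.trans hxn) (hε.1.trans hne) ?_ ?_ ?_ hTY hTe hb (hw _ ⟨hxn, hYρ⟩ _ ⟨hne, heρ⟩)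
      · rw [hes_norm, hs, div_pow, Real.sq_sqrt hl.le, mul_div_cancel₀ _ hl.ne']
      · rw [hes_norm, ← hB]
        simp only [map_smul, smul_apply, smul_eq_mul, heQ]
        ring
      · simp only [hWdef, sub_add_cancel]
        linarith
  refine ⟨?_, ?_⟩
  · have h1 := ht1.const_mul (τ ^ 2)
    have h2 : τ ^ 2 * 1 = -a / m := by rw [hτ2, mul_one, div_neg, neg_div]
    rw [h2] at h1
    refine h1.congr' ?_
    filter_upwards [hL.eventually_gt_atTop 0] with ε hl
    rw [ht, abs_of_neg (neg_pos.1 hl)]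
    field_simp
  · have h1 := (hq0.div (ht1.const_mul (τ ^ 2)) (by positivity)).const_mul (2 * m - (l₁ + l₂))
    have h2 := h1.sqrt
    simp only [zero_div, mul_zero, Real.sqrt_zero] at h2
    refine h2.congr' ?_
    filter_upwards [hL.eventually_gt_atTop 0, hYpos] with ε hl hYε
    set y := xε ε - x₀ with hy
    have hv : vnorm (fun i => (Hess u₀ x₀).mulVec (fun j => y j) i - m * y i) =
        √((2 * m - (l₁ + l₂)) * (m * ‖y‖ ^ 2 - B y y)) := by
      rw [hQ, norm_sq_eq_two, ← (hform _ _).2, vnorm]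
      simp [Matrix.mulVec, dotProduct, Fin.sum_univ_two, hsym]
    rw [hv, ← Real.sqrt_sq hYε.le, ← Real.sqrt_div' _ (sq_nonneg _), Real.sqrt_sq hYε.le]
    congr 1
    have hl' : Real.log ε ≠ 0 := (neg_pos.1 hl).ne
    simp only [hq, ht, Pi.div_apply, ← hy]
    field_simp
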